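/- Let a > 0 and q > 0 be real numbers and let θ ∈ (0,q). Then Σ_{k=0}^∞ (a/q)^k / ((k - θ/q)·k!) = 0 if and only if (a/q) · ∫_0^1 (1-x)^{-θ/q} e^{-ax/q} dx = 1. Equivalently, γ̄(-θ/q, -a/q) = 0 if and only if F(-θ/q, -a/q) = 1, where γ̄(s,x) = Σ_{k=0}^∞ (-x)^k / ((k+s)·k!) and F(s,x) = -x · ∫_0^1 (1-y)^s e^{xy} dy. -/

import Mathlib

lemma aux_congr {f g : ℕ → ℝ} {s : ℝ} (hg : HasSum g s) (h : ∀ k, f k = g k) : HasSum f s := by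
  rwa [funext h]

open MeasureTheory in
lemma aux_hasSum (c t : ℝ) (hc : 0 < c) (ht1 : t < 1) :
    HasSum (fun k : ℕ => c ^ k / (((k : ℝ) + 1 - t) * (k.factorial : ℝ)))
      (∫ y in (0:ℝ)..1, y ^ (-t) * Real.exp (c * y)) := by
  have hint : IntervalIntegrable (fun y : ℝ => y ^ (-t)) volume 0 1 :=
    intervalIntegral.intervalIntegrable_rpow' (by linarith)
  have hsum : Summable (fun k : ℕ => c ^ k / (k.factorial : ℝ)) := Real.summable_pow_div_factorial c
  have key := intervalIntegral.hasSum_integral_of_dominated_convergence (a := (0:ℝ)) (b := 1)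
    (μ := volume) (F := fun (k : ℕ) (y : ℝ) => y ^ (-t) * ((c * y) ^ k / (k.factorial : ℝ)))
    (f := fun y : ℝ => y ^ (-t) * Real.exp (c * y))
    (fun k y => y ^ (-t) * (c ^ k / (k.factorial : ℝ))) ?_ ?_ ?_ ?_ ?_
  · refine aux_congr (key) fun k => ?_
    have h1 : ∫ y in (0:ℝ)..1, y ^ (-t) * ((c * y) ^ k / (k.factorial : ℝ))
        = ∫ y in (0:ℝ)..1, (c ^ k / (k.factorial : ℝ)) * y ^ ((k : ℝ) - t) := by
      apply intervalIntegral.integral_congr_ae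
      refine Filter.Eventually.of_forall fun y hy => ?_
      rw [Set.uIoc_of_le zero_le_one] at hy
      have : y ^ ((k : ℝ) - t) = y ^ (-t) * y ^ k := by
        rw [← Real.rpow_natCast, ← Real.rpow_add hy.1]; congr 1; ring
      rw [this, mul_pow]; ring
    have hk : (0:ℝ) ≤ k := Nat.cast_nonneg k
    rw [h1, intervalIntegral.integral_const_mul, integral_rpow (Or.inl (by linarith)),
      Real.one_rpow, Real.zero_rpow (by linarith)]
    have : (k : ℝ) + 1 - t ≠ 0 := by linarith
    have h3 : (k : ℝ) - t + 1 = k + 1 - t := by ring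
    have := k.factorial_ne_zero
    rw [h3]
    field_simp
    ring
  · intro k
    apply Measurable.aestronglyMeasurable
    fun_prop
  · intro k
    refine Filter.Eventually.of_forall fun y hy => ?_
    rw [Set.uIoc_of_le zero_le_one] at hy
    have h0 := hy.1.le
    have := hy.2
    rw [Real.norm_of_nonneg (by positivity)]
    gcongr
    nlinarith
  · exact Filter.Eventually.of_forall fun y _ => hsum.mul_left _
  · simp_rw [tsum_mul_left]
    exact hint.mul_const _
  · refine Filter.Eventually.of_forall fun y _ => ?_
    apply HasSum.mul_left
    rw [Real.exp_eq_exp_ℝ]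
    exact NormedSpace.expSeries_div_hasSum_exp (c * y)

lemma aux_main (c t : ℝ) (hc : 0 < c) (ht0 : 0 < t) (ht1 : t < 1) :
    (∑' k : ℕ, c ^ k / (((k : ℝ) - t) * (k.factorial : ℝ)) = 0) ↔
      c * ∫ x in (0:ℝ)..1, (1 - x) ^ (-t) * Real.exp (-(c * x)) = 1 := by
  have hJ := aux_hasSum c t hc ht1
  set J := ∫ y in (0:ℝ)..1, y ^ (-t) * Real.exp (c * y) with hJd
  have hI : ∫ x in (0:ℝ)..1, (1 - x) ^ (-t) * Real.exp (-(c * x)) = Real.exp (-c) * J := by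
    have := intervalIntegral.integral_comp_sub_left (a := (0:ℝ)) (b := 1)
      (fun y : ℝ => Real.exp (-c) * (y ^ (-t) * Real.exp (c * y))) 1
    simp only [sub_self, sub_zero, intervalIntegral.integral_const_mul] at this
    rw [hJd, ← this, ← intervalIntegral.integral_const_mul]
    congr 1
    ext x
    have : Real.exp (-(c * x)) = Real.exp (-c) * Real.exp (c * (1 - x)) := by
      rw [← Real.exp_add]; congr 1; ring
    rw [this]; ring
  have hE : HasSum (fun k : ℕ => c ^ k / (k.factorial : ℝ)) (Real.exp c) := by
    rw [Real.exp_eq_exp_ℝ]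
    exact NormedSpace.expSeries_div_hasSum_exp c
  have hK : HasSum (fun k : ℕ => (k : ℝ) * (c ^ k / (((k : ℝ) - t) * (k.factorial : ℝ)))) (c * J) := by
    rw [← hasSum_nat_add_iff' 1]
    simp only [Finset.range_one, Finset.sum_singleton, Nat.cast_zero, zero_mul, sub_zero]
    refine aux_congr (hJ.mul_left c) fun k => ?_
    have hk : (0:ℝ) ≤ k := Nat.cast_nonneg k
    have h2 : (k : ℝ) + 1 - t ≠ 0 := by linarith
    have h3 : (k : ℝ) + 1 ≠ 0 := by linarith
    have := k.factorial_ne_zero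
    rw [Nat.factorial_succ]
    push_cast
    field_simp
    ring
  have hS : HasSum (fun k : ℕ => c ^ k / (((k : ℝ) - t) * (k.factorial : ℝ)))
      (t⁻¹ * (c * J - Real.exp c)) := by
    refine aux_congr ((hK.sub hE).mul_left t⁻¹) fun k => ?_
    have h2 : (k : ℝ) - t ≠ 0 := by
      rcases k with _ | k
      · simp; exact ht0.ne'
      · have hk : (0:ℝ) ≤ k := Nat.cast_nonneg k
        push_cast; linarith
    have := k.factorial_ne_zero
    field_simp
    ring
  rw [hS.tsum_eq, hI, Real.exp_neg]
  have := Real.exp_pos c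
  rw [mul_eq_zero, or_iff_right (inv_ne_zero ht0.ne'), sub_eq_zero]
  field_simp

/-- For real `a > 0`, `q > 0` and `θ ∈ (0,q)`:
`∑_{k=0}^∞ (a/q)^k / ((k - θ/q)·k!) = 0` if and only if
`(a/q) · ∫_0^1 (1-x)^{-θ/q} e^{-ax/q} dx = 1`. -/
theorem series_root_iff_integral_eq_one (a q θ : ℝ) (ha : 0 < a) (hq : 0 < q)
    (hθ : θ ∈ Set.Ioo 0 q) :
    (∑' k : ℕ, (a / q) ^ k / (((k : ℝ) - θ / q) * (k.factorial : ℝ)) = 0) ↔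
      (a / q) * ∫ x in (0:ℝ)..1, (1 - x) ^ (-θ / q) * Real.exp (-(a * x) / q) = 1 := by
  have h := aux_main (a / q) (θ / q) (div_pos ha hq) (div_pos hθ.1 hq) ((div_lt_one hq).2 hθ.2)
  have e1 : -θ / q = -(θ / q) := neg_div _ _
  have e2 : ∀ x, -(a * x) / q = -(a / q * x) := fun x => by ring
  simp only [e1, e2]
  exact h
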